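/- arXiv:1605.02966 — 2 statements merged into one kernel-verified Lean document; each statement's English description precedes it below -/
import Mathlib

section
/- Let γ be a gauge on ℝ^d (d ≥ 2). The unit ball {x : γ(x) ≤ 1} is rotund (contains no line segment in its boundary) if and only if for every x, y ∈ ℝ^d with x ≠ 0 there exists a unique α ∈ ℝ such that (αx + y) ⊥_B x. -/
open scoped RealInnerProductSpace

noncomputable section

variable {d : ℕ}

/-- A gauge on ℝ^d: nonnegative, vanishing only at 0, positively homogeneous, subadditive. -/
def IsGauge (γ : EuclideanSpace ℝ (Fin d) → ℝ) : Prop :=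
  (∀ x, 0 ≤ γ x) ∧ (∀ x, γ x = 0 → x = 0) ∧
  (∀ (x : EuclideanSpace ℝ (Fin d)) (l : ℝ), 0 < l → γ (l • x) = l * γ x) ∧
  (∀ x y, γ (x + y) ≤ γ x + γ y)

/-- The polar function of a gauge. -/
def polarGauge (γ : EuclideanSpace ℝ (Fin d) → ℝ) : EuclideanSpace ℝ (Fin d) → ℝ :=
  fun xs => sInf {l : ℝ | 0 < l ∧ ∀ x, ⟪xs, x⟫ ≤ l * γ x}

/-- The ε-subdifferential of f at x. -/
def epsSubdiff (f : EuclideanSpace ℝ (Fin d) → ℝ) (ε : ℝ) (x : EuclideanSpace ℝ (Fin d)) :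
    Set (EuclideanSpace ℝ (Fin d)) :=
  {xs | ∀ y, ⟪xs, y - x⟫ ≤ f y - f x + ε}

/-- ε-Birkhoff orthogonality: x ⊥_B^ε y iff γ x ≤ γ (x + λ y) + ε for all λ. -/
def BirkhoffEps (γ : EuclideanSpace ℝ (Fin d) → ℝ) (ε : ℝ)
    (x y : EuclideanSpace ℝ (Fin d)) : Prop :=
  ∀ l : ℝ, γ x ≤ γ (x + l • y) + ε

/-- The ε-directional derivative of f at x in direction y. -/
def epsDirDeriv (f : EuclideanSpace ℝ (Fin d) → ℝ) (ε : ℝ)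
    (x y : EuclideanSpace ℝ (Fin d)) : ℝ :=
  sInf {q : ℝ | ∃ l : ℝ, 0 < l ∧ q = (f (x + l • y) - f x + ε) / l}

theorem gauge_convex (γ : EuclideanSpace ℝ (Fin d) → ℝ) (hγ : IsGauge γ)
    (p q : EuclideanSpace ℝ (Fin d)) (a b : ℝ) (ha : 0 ≤ a) (hb : 0 ≤ b) :
    γ (a • p + b • q) ≤ a * γ p + b * γ q := by
  obtain ⟨h0, h1, h2, h3⟩ := hγ
  have hz : γ 0 = 0 := by
    have := h2 0 2 (by norm_num)
    rw [smul_zero] at this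
    linarith
  have h2' : ∀ x (l : ℝ), 0 ≤ l → γ (l • x) = l * γ x := by
    intro x l hl
    rcases hl.eq_or_lt with h | h
    · subst h; simp [hz]
    · exact h2 x l h
  rw [← h2' p a ha, ← h2' q b hb]
  exact h3 _ _

theorem gauge_exists_min (γ : EuclideanSpace ℝ (Fin d) → ℝ) (hγ : IsGauge γ)
    (x y : EuclideanSpace ℝ (Fin d)) (hx : x ≠ 0) :
    ∃ α : ℝ, ∀ β : ℝ, γ (α • x + y) ≤ γ (β • x + y) := by
  have hc := gauge_convex γ hγ
  have hconv : ConvexOn ℝ Set.univ (fun α : ℝ => γ (α • x + y)) := by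
    refine ⟨convex_univ, ?_⟩
    intro s _ t _ a b ha hb hab
    have := hc (s • x + y) (t • x + y) a b ha hb
    have e : (a • s + b • t) • x + y = a • (s • x + y) + b • (t • x + y) := by
      obtain rfl : b = 1 - a := by linarith
      simp only [smul_eq_mul]
      module
    simp only [e]
    simpa using this
  have hcont : Continuous (fun α : ℝ => γ (α • x + y)) := by
    rw [← continuousOn_univ]
    exact hconv.continuousOn isOpen_univ
  obtain ⟨h0, h1, h2, h3⟩ := hγ
  have hpos : ∀ z, z ≠ 0 → 0 < γ z := fun z hz =>
    lt_of_le_of_ne (h0 z) (fun h => hz (h1 z h.symm))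
  set c := min (γ x) (γ (-x)) with hcdef
  have hcpos : 0 < c := lt_min (hpos x hx) (hpos _ (neg_ne_zero.mpr hx))
  have hlow : ∀ α : ℝ, c * |α| + -γ (-y) ≤ γ (α • x + y) := by
    intro α
    have h4 : γ (α • x) ≤ γ (α • x + y) + γ (-y) := by
      have := h3 (α • x + y) (-y)
      simpa using this
    have h5 : c * |α| ≤ γ (α • x) := by
      rcases lt_trichotomy α 0 with h | h | h
      · have e : α • x = (-α) • (-x) := by simp
        rw [e, h2 _ _ (by linarith), abs_of_neg h]
        nlinarith [min_le_right (γ x) (γ (-x))]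
      · subst h; simpa using h0 _
      · rw [h2 _ _ h, abs_of_pos h]
        nlinarith [min_le_left (γ x) (γ (-x))]
    linarith
  have htend : Filter.Tendsto (fun α : ℝ => γ (α • x + y)) (Filter.cocompact ℝ) Filter.atTop := by
    refine Filter.tendsto_atTop_mono hlow ?_
    refine Filter.tendsto_atTop_add_const_right _ _ ?_
    exact Filter.Tendsto.const_mul_atTop hcpos (tendsto_norm_cocompact_atTop (E := ℝ))
  exact hcont.exists_forall_le htend

theorem rotund_iff_left_unique (hd : 2 ≤ d)
    (γ : EuclideanSpace ℝ (Fin d) → ℝ) (hγ : IsGauge γ) :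
    (¬ ∃ x y : EuclideanSpace ℝ (Fin d), x ≠ y ∧
        segment ℝ x y ⊆ {z : EuclideanSpace ℝ (Fin d) | γ z = 1}) ↔
    (∀ x y : EuclideanSpace ℝ (Fin d), x ≠ 0 →
      ∃! α : ℝ, BirkhoffEps γ 0 (α • x + y) x) := by
  have hc := gauge_convex γ hγ
  have hB : ∀ (x y : EuclideanSpace ℝ (Fin d)) (α : ℝ),
      BirkhoffEps γ 0 (α • x + y) x ↔ ∀ β : ℝ, γ (α • x + y) ≤ γ (β • x + y) := by
    intro x y α
    constructor
    · intro h β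
      have := h (β - α)
      have e : α • x + y + (β - α) • x = β • x + y := by module
      rwa [e, add_zero] at this
    · intro h l
      have e : α • x + y + l • x = (α + l) • x + y := by module
      rw [e, add_zero]
      exact h _
  simp only [hB]
  constructor
  · intro hrot x y hx
    obtain ⟨α, hα⟩ := gauge_exists_min γ hγ x y hx
    refine ⟨α, hα, ?_⟩
    intro β hβ
    by_contra hne
    have hm : γ (β • x + y) = γ (α • x + y) := le_antisymm (hβ α) (hα β)
    have hpq : α • x + y ≠ β • x + y := by
      intro h
      have h' : (β - α) • x = 0 := by
        rw [sub_smul, sub_eq_zero]; exact (add_right_cancel h).symm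
      rcases smul_eq_zero.mp h' with h | h
      · exact hne (by linarith)
      · exact hx h
    obtain ⟨h0, h1, h2, h3⟩ := hγ
    have hmpos : 0 < γ (α • x + y) := by
      refine lt_of_le_of_ne (h0 _) (fun h => hpq ?_)
      rw [h1 _ h.symm, h1 _ (hm.trans h.symm)]
    set m := γ (α • x + y) with hmdef
    have hmi : 0 < m⁻¹ := inv_pos.mpr hmpos
    refine hrot ⟨m⁻¹ • (α • x + y), m⁻¹ • (β • x + y), ?_, ?_⟩
    · intro h
      exact hpq (smul_right_injective _ hmi.ne' h)
    · rintro z ⟨a, b, ha, hb, hab, rfl⟩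
      have e1 : a • m⁻¹ • (α • x + y) + b • m⁻¹ • (β • x + y)
          = m⁻¹ • (a • (α • x + y) + b • (β • x + y)) := by module
      have e2 : a • (α • x + y) + b • (β • x + y) = (a * α + b * β) • x + y := by
        obtain rfl : b = 1 - a := by linarith
        module
      have hle := hc (α • x + y) (β • x + y) a b ha hb
      have hge := hα (a * α + b * β)
      rw [← e2] at hge
      rw [hm, ← hmdef, ← add_mul, hab, one_mul] at hle
      show γ _ = 1
      rw [e1, h2 _ _ hmi, le_antisymm hle hge]
      exact inv_mul_cancel₀ hmpos.ne'
  · rintro huniq ⟨x, y, hxy, hseg⟩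
    have hu : y - x ≠ 0 := sub_ne_zero.mpr hxy.symm
    have hx1 : γ x = 1 := hseg (left_mem_segment ℝ x y)
    have hy1 : γ y = 1 := hseg (right_mem_segment ℝ x y)
    have hge : ∀ β : ℝ, 1 ≤ γ (β • (y - x) + x) := by
      intro β
      rcases lt_or_ge β 0 with h | h
      · -- x is a convex combination of the point and y
        have hp : 0 < 1 - β := by linarith
        have := hc (β • (y - x) + x) y 1 (-β) (by norm_num) (by linarith)
        have e : (1 : ℝ) • (β • (y - x) + x) + (-β) • y = (1 - β) • x := by module
        rw [e, hγ.2.2.1 _ _ hp, hx1, hy1] at this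
        linarith
      · rcases le_or_gt β 1 with h' | h'
        · refine le_of_eq (Eq.symm (hseg ⟨1 - β, β, by linarith, h, by ring, ?_⟩))
          module
        · have := hc (β • (y - x) + x) x 1 (β - 1) (by norm_num) (by linarith)
          have e : (1 : ℝ) • (β • (y - x) + x) + (β - 1) • x = β • y := by module
          rw [e, hγ.2.2.1 _ _ (by linarith), hx1, hy1] at this
          linarith
    have := (huniq (y - x) x hu).unique (y₁ := 0) (y₂ := 1)
      (fun β => by simpa [hx1] using hge β) (fun β => by simpa [hy1] using hge β)
    exact zero_ne_one this
end
end

section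
/- Let γ be a gauge on ℝ^d, y, z ∈ ℝ^d, λ ∈ (0,1), w = λy + (1−λ)z, and x ∈ ℝ^d. Then γ(w − x) ≤ max{γ(y − x), γ(z − x)}, with equality if and only if γ(w − x) = γ(y − x) = γ(z − x). In the case of equality, γ(w − x) = min{γ(v − x) : v on the line through y and z} and γ(v − x) = γ(w − x) for all v in the segment [y, z]. -/
open scoped RealInnerProductSpace

noncomputable section

variable {d : ℕ}

theorem gauge_line_convex (γ : EuclideanSpace ℝ (Fin d) → ℝ) (hγ : IsGauge γ)
    (y z x : EuclideanSpace ℝ (Fin d)) (p s q : ℝ) (h1 : p < s) (h2 : s < q) :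
    (q - p) * γ (y + s • (z - y) - x) ≤
      (q - s) * γ (y + p • (z - y) - x) + (s - p) * γ (y + q • (z - y) - x) := by
  obtain ⟨-, -, hom, sub⟩ := hγ
  rw [← hom _ (q - p) (by linarith), ← hom _ (q - s) (by linarith),
    ← hom _ (s - p) (by linarith)]
  refine le_trans (le_of_eq ?_) (sub _ _)
  congr 1
  module

theorem unimodality (γ : EuclideanSpace ℝ (Fin d) → ℝ) (hγ : IsGauge γ)
    (y z : EuclideanSpace ℝ (Fin d)) (l : ℝ) (hl : l ∈ Set.Ioo (0 : ℝ) 1)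
    (x w : EuclideanSpace ℝ (Fin d)) (hw : w = l • y + (1 - l) • z) :
    γ (w - x) ≤ max (γ (y - x)) (γ (z - x)) ∧
    (γ (w - x) = max (γ (y - x)) (γ (z - x)) ↔
      γ (w - x) = γ (y - x) ∧ γ (w - x) = γ (z - x)) ∧
    (γ (w - x) = γ (y - x) ∧ γ (w - x) = γ (z - x) →
      (∀ t : ℝ, γ (w - x) ≤ γ (y + t • (z - y) - x)) ∧
      ∀ v ∈ segment ℝ y z, γ (v - x) = γ (w - x)) := by
  obtain ⟨hl0, hl1⟩ := hl
  have key := gauge_line_convex γ hγ y z x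
  have hy : y - x = y + (0 : ℝ) • (z - y) - x := by module
  have hz : z - x = y + (1 : ℝ) • (z - y) - x := by module
  have hw' : w - x = y + (1 - l) • (z - y) - x := by rw [hw]; module
  have hseg : ∀ v ∈ segment ℝ y z, ∃ t : ℝ, 0 ≤ t ∧ t ≤ 1 ∧
      v - x = y + t • (z - y) - x := by
    rintro v ⟨a, b, ha, hb, hab, rfl⟩
    refine ⟨b, hb, by linarith, ?_⟩
    obtain rfl : a = 1 - b := by linarith
    module
  rw [hy, hz, hw']
  generalize hg : (fun t : ℝ => γ (y + t • (z - y) - x)) = g at *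
  have hg' : ∀ t : ℝ, γ (y + t • (z - y) - x) = g t := fun t => by rw [← hg]
  simp only [hg'] at key ⊢
  have k := key 0 (1 - l) 1 (by linarith) (by linarith)
  refine ⟨?_, ⟨?_, ?_⟩, ?_⟩
  · have := le_max_left (g 0) (g 1)
    have := le_max_right (g 0) (g 1)
    nlinarith
  · intro h
    rcases le_total (g 0) (g 1) with h' | h'
    · rw [max_eq_right h'] at h
      refine ⟨?_, h⟩
      rw [h] at k ⊢
      nlinarith
    · rw [max_eq_left h'] at h
      refine ⟨h, ?_⟩
      rw [h] at k ⊢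
      nlinarith
  · rintro ⟨h0, h1⟩
    rw [← h0, ← h1, max_self]
  · rintro ⟨h0, h1⟩
    have hmin : ∀ t : ℝ, g (1 - l) ≤ g t := by
      intro t
      rcases lt_trichotomy t (1 - l) with h | h | h
      · have k' := key t (1 - l) 1 h (by linarith)
        rw [← h1] at k'
        have : l * g (1 - l) ≤ l * g t := by linarith
        exact le_of_mul_le_mul_left this hl0
      · rw [h]
      · have k' := key 0 (1 - l) t (by linarith) h
        rw [← h0] at k'
        have : (1 - l) * g (1 - l) ≤ (1 - l) * g t := by linarith
        exact le_of_mul_le_mul_left this (by linarith)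
    refine ⟨hmin, fun v hv => ?_⟩
    obtain ⟨t, ht0, ht1, hvt⟩ := hseg v hv
    rw [hvt, hg']
    refine le_antisymm ?_ (hmin t)
    rcases ht0.eq_or_lt with h | h
    · rw [← h, h0]
    rcases ht1.eq_or_lt with h' | h'
    · rw [h', h1]
    have k' := key 0 t 1 h h'
    rw [← h0, ← h1] at k'
    linarith
end
end
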